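/- Completeness of Λ_R' with respect to bi-valued Kripke-kios-models: every Λ_R'-consistent formula of L_R is true at some world of some bi-valued Kripke-kios-model. -/

import Mathlib

namespace IEAUST

variable {Agent Mom : Type}

/-- Histories: maximal chains of moments. -/
abbrev Hist (lt : Mom → Mom → Prop) : Type _ := {s : Set Mom // IsMaxChain lt s}

/-- An index is a pair of a moment and a history passing through it. -/
structure Idx (lt : Mom → Mom → Prop) where
  mom : Mom
  hist : Hist lt
  mem : mom ∈ hist.val

/-- The ex ante information set of an agent at an index. -/
def exAnte {lt : Mom → Mom → Prop} (epi : Agent → Idx lt → Idx lt → Prop)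
    (a : Agent) (i : Idx lt) : Set (Idx lt) :=
  {j | ∃ (h'' : Hist lt) (p : j.mom ∈ h''.val), epi a i ⟨j.mom, h'', p⟩}

/-- Formulas of the language `L_R` (atomic propositions indexed by `ℕ`). -/
inductive Formula (Agent : Type) : Type
  | atom : ℕ → Formula Agent
  | neg : Formula Agent → Formula Agent
  | conj : Formula Agent → Formula Agent → Formula Agent
  | box : Formula Agent → Formula Agent
  | stit : Agent → Formula Agent → Formula Agent
  | know : Agent → Formula Agent → Formula Agent
  | intend : Agent → Formula Agent → Formula Agent
  | oughtO : Agent → Formula Agent → Formula Agent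
  | oughtS : Agent → Formula Agent → Formula Agent

/-- `◇φ := ¬□¬φ`. -/
def Formula.diam (φ : Formula Agent) : Formula Agent := .neg (.box (.neg φ))

/-- Material implication `φ → ψ := ¬(φ ∧ ¬ψ)`. -/
def Formula.imp (φ ψ : Formula Agent) : Formula Agent := .neg (.conj φ (.neg ψ))

/-- Purely propositional formulas, used to state the axiom schema of
propositional tautologies. -/
inductive PropForm : Type
  | var : ℕ → PropForm
  | neg : PropForm → PropForm
  | conj : PropForm → PropForm → PropForm

/-- Classical evaluation of a propositional form. -/
def PropForm.eval (v : ℕ → Prop) : PropForm → Prop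
  | .var n => v n
  | .neg p => ¬ PropForm.eval v p
  | .conj p q => PropForm.eval v p ∧ PropForm.eval v q

/-- Substitute formulas for the variables of a propositional form. -/
def PropForm.toFormula (σ : ℕ → Formula Agent) : PropForm → Formula Agent
  | .var n => σ n
  | .neg p => .neg (PropForm.toFormula σ p)
  | .conj p q => .conj (PropForm.toFormula σ p) (PropForm.toFormula σ q)

/-- `φ` is a substitution instance of a classical propositional tautology. -/
def Formula.isTautInstance (φ : Formula Agent) : Prop :=
  ∃ (p : PropForm) (σ : ℕ → Formula Agent),
    (∀ v : ℕ → Prop, PropForm.eval v p) ∧ φ = PropForm.toFormula σ p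

/-- Uniform substitution of formulas for atomic propositions. -/
def Formula.subst (σ : ℕ → Formula Agent) : Formula Agent → Formula Agent
  | .atom n => σ n
  | .neg φ => .neg (Formula.subst σ φ)
  | .conj φ ψ => .conj (Formula.subst σ φ) (Formula.subst σ ψ)
  | .box φ => .box (Formula.subst σ φ)
  | .stit a φ => .stit a (Formula.subst σ φ)
  | .know a φ => .know a (Formula.subst σ φ)
  | .intend a φ => .intend a (Formula.subst σ φ)
  | .oughtO a φ => .oughtO a (Formula.subst σ φ)
  | .oughtS a φ => .oughtS a (Formula.subst σ φ)

/-- Conjunction of a nonempty list of formulas (head and tail). -/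
def bigConj : Formula Agent → List (Formula Agent) → Formula Agent
  | φ, [] => φ
  | φ, ψ :: l => .conj φ (bigConj ψ l)

/-- The proof system `Lambda_R'`. -/
inductive Lambda_R' {Agent : Type} : Formula Agent → Prop
  /-- All classical propositional tautologies. -/
  | taut {φ : Formula Agent} : φ.isTautInstance → Lambda_R' φ
  /-- S5 for `□`: K. -/
  | boxK (φ ψ : Formula Agent) :
      Lambda_R' ((Formula.box (φ.imp ψ)).imp ((Formula.box φ).imp (Formula.box ψ)))
  /-- S5 for `□`: T. -/
  | boxT (φ : Formula Agent) : Lambda_R' ((Formula.box φ).imp φ)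
  /-- S5 for `□`: 5. -/
  | box5 (φ : Formula Agent) :
      Lambda_R' ((Formula.diam φ).imp (Formula.box (Formula.diam φ)))
  /-- S5 for `[α]`: K. -/
  | stitK (a : Agent) (φ ψ : Formula Agent) :
      Lambda_R' ((Formula.stit a (φ.imp ψ)).imp ((Formula.stit a φ).imp (Formula.stit a ψ)))
  /-- S5 for `[α]`: T. -/
  | stitT (a : Agent) (φ : Formula Agent) : Lambda_R' ((Formula.stit a φ).imp φ)
  /-- S5 for `[α]`: 5. -/
  | stit5 (a : Agent) (φ : Formula Agent) :
      Lambda_R' ((Formula.neg (Formula.stit a (Formula.neg φ))).imp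
        (Formula.stit a (Formula.neg (Formula.stit a (Formula.neg φ)))))
  /-- S5 for `K_α`: K. -/
  | knowK (a : Agent) (φ ψ : Formula Agent) :
      Lambda_R' ((Formula.know a (φ.imp ψ)).imp ((Formula.know a φ).imp (Formula.know a ψ)))
  /-- S5 for `K_α`: T. -/
  | knowT (a : Agent) (φ : Formula Agent) : Lambda_R' ((Formula.know a φ).imp φ)
  /-- S5 for `K_α`: 5. -/
  | know5 (a : Agent) (φ : Formula Agent) :
      Lambda_R' ((Formula.neg (Formula.know a (Formula.neg φ))).imp
        (Formula.know a (Formula.neg (Formula.know a (Formula.neg φ)))))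
  /-- KD for `I_α`: K. -/
  | intK (a : Agent) (φ ψ : Formula Agent) :
      Lambda_R' ((Formula.intend a (φ.imp ψ)).imp
        ((Formula.intend a φ).imp (Formula.intend a ψ)))
  /-- KD for `I_α`: D. -/
  | intD (a : Agent) (φ : Formula Agent) :
      Lambda_R' ((Formula.intend a φ).imp (Formula.neg (Formula.intend a (Formula.neg φ))))
  /-- (SET). -/
  | set (a : Agent) (φ : Formula Agent) : Lambda_R' ((Formula.box φ).imp (Formula.stit a φ))
  /-- (IA), for pairwise-distinct agents. -/
  | indep (p : Agent × Formula Agent) (l : List (Agent × Formula Agent))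
      (hd : ((p :: l).map Prod.fst).Nodup) :
      Lambda_R' ((bigConj (Formula.diam (Formula.stit p.1 p.2))
          (l.map fun q => Formula.diam (Formula.stit q.1 q.2))).imp
        (Formula.diam (bigConj (Formula.stit p.1 p.2)
          (l.map fun q => Formula.stit q.1 q.2))))
  /-- (OAC). -/
  | oac (a : Agent) (φ : Formula Agent) : Lambda_R' ((Formula.know a φ).imp (Formula.stit a φ))
  /-- (Unif-H). -/
  | unifH (a : Agent) (φ : Formula Agent) :
      Lambda_R' ((Formula.diam (Formula.know a φ)).imp (Formula.know a (Formula.diam φ)))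
  /-- (A1). -/
  | a1 (a : Agent) (φ ψ : Formula Agent) :
      Lambda_R' ((Formula.oughtO a (φ.imp ψ)).imp
        ((Formula.oughtO a φ).imp (Formula.oughtO a ψ)))
  /-- (A2). -/
  | a2 (a : Agent) (φ : Formula Agent) : Lambda_R' ((Formula.box φ).imp (Formula.oughtO a φ))
  /-- (A3). -/
  | a3 (a : Agent) (φ : Formula Agent) :
      Lambda_R' ((Formula.oughtO a φ).imp (Formula.box (Formula.oughtO a φ)))
  /-- (A4). -/
  | a4 (a : Agent) (φ : Formula Agent) :
      Lambda_R' ((Formula.oughtO a φ).imp (Formula.oughtO a (Formula.stit a φ)))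
  /-- (Oic). -/
  | oic (a : Agent) (φ : Formula Agent) :
      Lambda_R' ((Formula.oughtO a φ).imp (Formula.diam (Formula.stit a φ)))
  /-- (A5). -/
  | a5 (a : Agent) (φ ψ : Formula Agent) :
      Lambda_R' ((Formula.oughtS a (φ.imp ψ)).imp
        ((Formula.oughtS a φ).imp (Formula.oughtS a ψ)))
  /-- (A6). -/
  | a6 (a : Agent) (φ : Formula Agent) :
      Lambda_R' ((Formula.oughtS a φ).imp (Formula.oughtS a (Formula.know a φ)))
  /-- (SuN). -/
  | suN (a : Agent) (φ : Formula Agent) :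
      Lambda_R' ((Formula.know a (Formula.box φ)).imp (Formula.oughtS a φ))
  /-- (s.Oic). -/
  | sOic (a : Agent) (φ : Formula Agent) :
      Lambda_R' ((Formula.oughtS a φ).imp (Formula.diam (Formula.know a φ)))
  /-- (s.Cl). -/
  | sCl (a : Agent) (φ : Formula Agent) :
      Lambda_R' ((Formula.oughtS a φ).imp (Formula.know a (Formula.box (Formula.oughtS a φ))))
  /-- (InN). -/
  | inN (a : Agent) (φ : Formula Agent) :
      Lambda_R' ((Formula.box (Formula.know a φ)).imp (Formula.intend a φ))
  /-- (KI). -/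
  | ki (a : Agent) (φ : Formula Agent) :
      Lambda_R' ((Formula.intend a φ).imp (Formula.box (Formula.know a (Formula.intend a φ))))
  /-- Modus ponens. -/
  | mp {φ ψ : Formula Agent} : Lambda_R' (φ.imp ψ) → Lambda_R' φ → Lambda_R' ψ
  /-- Uniform substitution. -/
  | subst {φ : Formula Agent} (σ : ℕ → Formula Agent) :
      Lambda_R' φ → Lambda_R' (φ.subst σ)
  /-- Necessitation for `□`. -/
  | necBox {φ : Formula Agent} : Lambda_R' φ → Lambda_R' (Formula.box φ)
  /-- Necessitation for `[α]`. -/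
  | necStit (a : Agent) {φ : Formula Agent} : Lambda_R' φ → Lambda_R' (Formula.stit a φ)
  /-- Necessitation for `K_α`. -/
  | necKnow (a : Agent) {φ : Formula Agent} : Lambda_R' φ → Lambda_R' (Formula.know a φ)
  /-- Necessitation for `I_α`. -/
  | necInt (a : Agent) {φ : Formula Agent} : Lambda_R' φ → Lambda_R' (Formula.intend a φ)
  /-- Necessitation for `⊙_α`. -/
  | necOO (a : Agent) {φ : Formula Agent} : Lambda_R' φ → Lambda_R' (Formula.oughtO a φ)
  /-- Necessitation for `⊙^S_α`. -/
  | necOS (a : Agent) {φ : Formula Agent} : Lambda_R' φ → Lambda_R' (Formula.oughtS a φ)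

/-- A bi-valued Kripke-kios-model. -/
structure KripkeModel (Agent : Type) where
  W : Type
  ags_fin : Finite Agent
  rbox : W → W → Prop
  rbox_equiv : Equivalence rbox
  Choice : Agent → W → Set (Set W)
  choice_congr : ∀ a w v, rbox w v → Choice a w = Choice a v
  choice_sub : ∀ a w, ∀ L ∈ Choice a w, ∀ u ∈ L, rbox w u
  choice_ne : ∀ a w, ∀ L ∈ Choice a w, L.Nonempty
  choice_cover : ∀ a w v, rbox w v → ∃ L ∈ Choice a w, v ∈ L
  choice_disj : ∀ a w, ∀ L ∈ Choice a w, ∀ L' ∈ Choice a w, ∀ v, v ∈ L → v ∈ L' → L = L'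
  ia : ∀ w (s : Agent → Set W), (∀ a, s a ∈ Choice a w) → (⋂ a, s a).Nonempty
  aeq : Agent → W → W → Prop
  aeq_equiv : ∀ a, Equivalence (aeq a)
  oacK : ∀ a v, ∀ L ∈ Choice a v, v ∈ L → ∀ u ∈ L, aeq a v u
  unifHK : ∀ a v u, aeq a v u → ∀ v', rbox v v' → ∃ u', rbox u u' ∧ aeq a v' u'
  ri : Agent → W → W → Prop
  ri_serial : ∀ a w, ∃ v, ri a w v
  ri_trans : ∀ a {x y z}, ri a x y → ri a y z → ri a x z
  ri_eucl : ∀ a {x y z}, ri a x y → ri a x z → ri a y z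
  ri_sub : ∀ a {x y}, ri a x y → ∃ z, aeq a x z ∧ rbox z y
  denK : ∀ a v u, (∃ y, aeq a v y ∧ rbox y u) → ∃ z, ri a v z ∧ ri a u z
  ValueO : W → ℝ
  ValueS : W → ℝ
  val : ℕ → Set W

/-- `State^w̄_β` in a Kripke-kios-model. -/
def kState (M : KripkeModel Agent) (b : Agent) (w : M.W) : Set (Set M.W) :=
  {S | ∃ s : Agent → Set M.W, (∀ a, s a ∈ M.Choice a w) ∧
        S = ⋂ a ∈ {a : Agent | a ≠ b}, s a}

/-- `X ≤ Y` via `Value_O`. -/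
def kleO (M : KripkeModel Agent) (X Y : Set M.W) : Prop :=
  ∀ x ∈ X, ∀ y ∈ Y, M.ValueO x ≤ M.ValueO y

/-- `X ≤_s Y` via `Value_S`. -/
def kleS (M : KripkeModel Agent) (X Y : Set M.W) : Prop :=
  ∀ x ∈ X, ∀ y ∈ Y, M.ValueS x ≤ M.ValueS y

/-- Objective dominance `L ≼ L'` in a Kripke-kios-model. -/
def kdom (M : KripkeModel Agent) (a : Agent) (w : M.W) (L L' : Set M.W) : Prop :=
  ∀ S ∈ kState M a w, kleO M (L ∩ S) (L' ∩ S)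

/-- The epistemic cluster `⟦L⟧^v̄_α`. -/
def kcluster (M : KripkeModel Agent) (a : Agent) (L : Set M.W) (v : M.W) : Set M.W :=
  {u | M.rbox v u ∧ ∃ o ∈ L, M.aeq a o u}

/-- Subjective dominance `L ≼_s L'` in a Kripke-kios-model. -/
def kdomS (M : KripkeModel Agent) (a : Agent) (w : M.W) (L L' : Set M.W) : Prop :=
  ∀ v, M.aeq a w v → ∀ S ∈ kState M a v,
    kleS M (kcluster M a L v ∩ S) (kcluster M a L' v ∩ S)

/-- Truth at a world of a bi-valued Kripke-kios-model. -/
def ktruth (M : KripkeModel Agent) : Formula Agent → M.W → Prop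
  | .atom n, w => w ∈ M.val n
  | .neg φ, w => ¬ ktruth M φ w
  | .conj φ ψ, w => ktruth M φ w ∧ ktruth M ψ w
  | .box φ, w => ∀ v, M.rbox w v → ktruth M φ v
  | .stit a φ, w => ∀ L ∈ M.Choice a w, w ∈ L → ∀ v ∈ L, ktruth M φ v
  | .know a φ, w => ∀ v, M.aeq a w v → ktruth M φ v
  | .intend a φ, w => ∃ x, (∃ y, M.aeq a w y ∧ M.rbox y x) ∧
      ∀ v, (x = v ∨ M.ri a x v) → ktruth M φ v
  | .oughtO a φ, w => ∀ L ∈ M.Choice a w, (∃ v ∈ L, ¬ ktruth M φ v) →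
      ∃ L' ∈ M.Choice a w, (kdom M a w L L' ∧ ¬ kdom M a w L' L) ∧
        ∀ L'' ∈ M.Choice a w, (L'' = L' ∨ kdom M a w L' L'') → ∀ u ∈ L'', ktruth M φ u
  | .oughtS a φ, w => ∀ L ∈ M.Choice a w,
      (∃ w', M.aeq a w w' ∧ ∃ v ∈ kcluster M a L w', ¬ ktruth M φ v) →
      ∃ L' ∈ M.Choice a w, (kdomS M a w L L' ∧ ¬ kdomS M a w L' L) ∧
        ∀ L'' ∈ M.Choice a w, (L'' = L' ∨ kdomS M a w L' L'') →
          ∀ w'', (∃ x, M.rbox w x ∧ ∃ y, M.rbox w'' y ∧ M.aeq a x y) →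
            ∀ u ∈ kcluster M a L'' w'', ktruth M φ u

/-! ### Theories and maximal consistent sets -/

/-- A propositional form in at most three variables, instantiated at three formulas. -/
theorem Lambda_R'.ofForm (p : PropForm) (hp : ∀ v, PropForm.eval v p) (φ ψ χ : Formula Agent) :
    Lambda_R' (p.toFormula fun n => if n = 0 then φ else if n = 1 then ψ else χ) :=
  .taut ⟨p, _, hp, rfl⟩

/-- Implication of propositional forms. -/
def PropForm.imp (p q : PropForm) : PropForm := .neg (.conj p (.neg q))

theorem PropForm.eval_imp (v : ℕ → Prop) (p q : PropForm) :
    PropForm.eval v (p.imp q) ↔ (PropForm.eval v p → PropForm.eval v q) := by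
  simp [PropForm.imp, PropForm.eval]

theorem Lambda_R'.imp_self (φ : Formula Agent) : Lambda_R' (φ.imp φ) :=
  ofForm (.imp (.var 0) (.var 0)) (fun v => by simp [PropForm.eval_imp]) φ φ φ

theorem Lambda_R'.imp_intro (φ ψ : Formula Agent) : Lambda_R' (φ.imp (ψ.imp φ)) :=
  ofForm (.imp (.var 0) (.imp (.var 1) (.var 0)))
    (fun v => by simp only [PropForm.eval_imp]; tauto) φ ψ ψ

theorem Lambda_R'.imp_dist (φ ψ χ : Formula Agent) :
    Lambda_R' ((φ.imp (ψ.imp χ)).imp ((φ.imp ψ).imp (φ.imp χ))) :=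
  ofForm (.imp (.imp (.var 0) (.imp (.var 1) (.var 2)))
    (.imp (.imp (.var 0) (.var 1)) (.imp (.var 0) (.var 2))))
    (fun v => by simp only [PropForm.eval_imp]; tauto) φ ψ χ

theorem Lambda_R'.by_cases (φ ψ : Formula Agent) :
    Lambda_R' ((φ.imp ψ).imp ((φ.neg.imp ψ).imp ψ)) :=
  ofForm (.imp (.imp (.var 0) (.var 1)) (.imp (.imp (.neg (.var 0)) (.var 1)) (.var 1)))
    (fun v => by simp only [PropForm.eval_imp, PropForm.eval]; tauto) φ ψ ψ

theorem Lambda_R'.explosion (φ ψ : Formula Agent) : Lambda_R' (φ.imp (φ.neg.imp ψ)) :=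
  ofForm (.imp (.var 0) (.imp (.neg (.var 0)) (.var 1)))
    (fun v => by simp only [PropForm.eval_imp, PropForm.eval]; tauto) φ ψ ψ

theorem Lambda_R'.conj_left (φ ψ : Formula Agent) : Lambda_R' ((φ.conj ψ).imp φ) :=
  ofForm (.imp (.conj (.var 0) (.var 1)) (.var 0))
    (fun v => by simp only [PropForm.eval_imp, PropForm.eval]; tauto) φ ψ ψ

theorem Lambda_R'.conj_right (φ ψ : Formula Agent) : Lambda_R' ((φ.conj ψ).imp ψ) :=
  ofForm (.imp (.conj (.var 0) (.var 1)) (.var 1))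
    (fun v => by simp only [PropForm.eval_imp, PropForm.eval]; tauto) φ ψ ψ

theorem Lambda_R'.conj_intro (φ ψ : Formula Agent) :
    Lambda_R' (φ.imp (ψ.imp (φ.conj ψ))) :=
  ofForm (.imp (.var 0) (.imp (.var 1) (.conj (.var 0) (.var 1))))
    (fun v => by simp only [PropForm.eval_imp, PropForm.eval]; tauto) φ ψ ψ

/-- Sets of formulas containing all theorems and closed under modus ponens. -/
structure IsTheory (T : Set (Formula Agent)) : Prop where
  thm : ∀ {φ}, Lambda_R' φ → φ ∈ T
  mp : ∀ {φ ψ}, φ.imp ψ ∈ T → φ ∈ T → ψ ∈ T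

/-- Maximal consistent sets of formulas. -/
structure IsMCS (T : Set (Formula Agent)) : Prop extends IsTheory T where
  neg_mem : ∀ φ, φ.neg ∈ T ↔ φ ∉ T

theorem isTheory_lambda : IsTheory {φ : Formula Agent | Lambda_R' φ} :=
  ⟨id, .mp⟩

theorem IsTheory.adjoin {T : Set (Formula Agent)} (hT : IsTheory T) (φ : Formula Agent) :
    IsTheory {ψ | φ.imp ψ ∈ T} where
  thm h := hT.thm (.mp (.imp_intro _ _) h)
  mp h₁ h₂ := hT.mp (hT.mp (hT.thm (.imp_dist _ _ _)) h₁) h₂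

/-- Lindenbaum's lemma. -/
theorem IsTheory.exists_mcs {T : Set (Formula Agent)} (hT : IsTheory T) {φ : Formula Agent}
    (hφ : φ ∉ T) : ∃ M, IsMCS M ∧ T ⊆ M ∧ φ ∉ M := by
  obtain ⟨M, hTM, hM⟩ := zorn_subset_nonempty {M | IsTheory M ∧ φ ∉ M} (by
    intro c hc hchain hne
    refine ⟨⋃₀ c, ⟨⟨?_, ?_⟩, ?_⟩, fun s hs => Set.subset_sUnion_of_mem hs⟩
    · intro ψ hψ
      obtain ⟨s, hs⟩ := hne
      exact ⟨s, hs, (hc hs).1.thm hψ⟩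
    · rintro ψ χ ⟨s, hs, h₁⟩ ⟨t, ht, h₂⟩
      rcases hchain.total hs ht with h | h
      · exact ⟨t, ht, (hc ht).1.mp (h h₁) h₂⟩
      · exact ⟨s, hs, (hc hs).1.mp h₁ (h h₂)⟩
    · rintro ⟨s, hs, h⟩
      exact (hc hs).2 h) T ⟨hT, hφ⟩
  have key : ∀ ψ, ψ ∉ M → ψ.imp φ ∈ M := by
    intro ψ hψ
    by_contra hn
    refine hψ (hM.2 (y := {χ | ψ.imp χ ∈ M}) ⟨hM.1.1.adjoin ψ, hn⟩ ?_ (hM.1.1.thm (.imp_self ψ)))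
    exact fun χ hχ => hM.1.1.mp (hM.1.1.thm (.imp_intro _ _)) hχ
  refine ⟨M, ⟨hM.1.1, fun ψ => ⟨fun h₁ h₂ => ?_, fun h => ?_⟩⟩, hTM, hM.1.2⟩
  · exact hM.1.2 (hM.1.1.mp (hM.1.1.mp (hM.1.1.thm (.explosion ψ φ)) h₂) h₁)
  · by_contra hn
    exact hM.1.2 (hM.1.1.mp (hM.1.1.mp (hM.1.1.thm (.by_cases ψ φ)) (key _ h)) (key _ hn))

/-- The worlds of the canonical model. -/
abbrev World (Agent : Type) : Type := {T : Set (Formula Agent) // IsMCS T}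

theorem World.neg_mem (w : World Agent) {φ : Formula Agent} : φ.neg ∈ w.1 ↔ φ ∉ w.1 :=
  w.2.neg_mem φ

theorem World.mp (w : World Agent) {φ ψ : Formula Agent} (h : Lambda_R' (φ.imp ψ))
    (hφ : φ ∈ w.1) : ψ ∈ w.1 :=
  w.2.mp (w.2.thm h) hφ

theorem World.conj_mem (w : World Agent) {φ ψ : Formula Agent} :
    φ.conj ψ ∈ w.1 ↔ φ ∈ w.1 ∧ ψ ∈ w.1 :=
  ⟨fun h => ⟨w.mp (.conj_left _ _) h, w.mp (.conj_right _ _) h⟩,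
    fun h => w.2.mp (w.mp (.conj_intro _ _) h.1) h.2⟩

theorem World.imp_mem (w : World Agent) {φ ψ : Formula Agent} :
    φ.imp ψ ∈ w.1 ↔ (φ ∈ w.1 → ψ ∈ w.1) := by
  simp [Formula.imp, w.neg_mem, w.conj_mem]

/-- A formula lying in every maximal consistent set is a theorem. -/
theorem Lambda_R'.of_forall_world {φ : Formula Agent} (h : ∀ w : World Agent, φ ∈ w.1) :
    Lambda_R' φ := by
  by_contra hn
  obtain ⟨M, hM, -, hφ⟩ := isTheory_lambda.exists_mcs hn
  exact hφ (h ⟨M, hM⟩)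

/-- Two theories not refuting each other have a common maximal consistent extension. -/
theorem IsTheory.exists_common_world {S T : Set (Formula Agent)} (hS : IsTheory S)
    (hT : IsTheory T) (h : ∀ φ ∈ S, φ.neg ∉ T) : ∃ w : World Agent, S ⊆ w.1 ∧ T ⊆ w.1 := by
  have hU : IsTheory {χ | ∃ φ ∈ S, φ.imp χ ∈ T} := by
    refine ⟨fun {χ} hχ => ⟨χ, hS.thm hχ, hT.thm (.imp_self _)⟩, ?_⟩
    rintro χ ξ ⟨φ, hφ, h₁⟩ ⟨ψ, hψ, h₂⟩
    refine ⟨φ.conj ψ, hS.mp (hS.mp (hS.thm (.conj_intro _ _)) hφ) hψ, ?_⟩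
    refine hT.mp (hT.mp (hT.thm (.of_forall_world fun w => ?_)) h₁) h₂
    simp only [w.imp_mem, w.conj_mem]
    tauto
  let φ₀ : Formula Agent := ((Formula.atom 0).imp (.atom 0)).neg
  obtain ⟨M, hM, hUM, -⟩ := hU.exists_mcs (φ := φ₀) (by
    rintro ⟨φ, hφ, hT'⟩
    refine h φ hφ (hT.mp (hT.thm (.of_forall_world fun w => ?_)) hT')
    simp only [φ₀, w.imp_mem, w.neg_mem]
    tauto)
  exact ⟨⟨M, hM⟩, fun φ hφ => hUM ⟨φ, hφ, hT.thm (.imp_self _)⟩,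
    fun φ hφ => hUM ⟨φ₀.neg, hS.thm (.of_forall_world fun w => by
      simp [φ₀, w.imp_mem, w.neg_mem]), hT.mp (hT.thm (.imp_intro _ _)) hφ⟩⟩

/-! ### Canonical relations -/

/-- Normality of a unary operator on formulas. -/
structure IsNormal (m : Formula Agent → Formula Agent) : Prop where
  dist : ∀ φ ψ, Lambda_R' ((m (φ.imp ψ)).imp ((m φ).imp (m ψ)))
  nec : ∀ {φ}, Lambda_R' φ → Lambda_R' (m φ)

/-- `S5` operators. -/
structure IsS5 (m : Formula Agent → Formula Agent) : Prop extends IsNormal m where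
  refl : ∀ φ, Lambda_R' ((m φ).imp φ)
  eucl : ∀ φ : Formula Agent, Lambda_R' ((m φ.neg).neg.imp (m (m φ.neg).neg))

/-- The canonical accessibility relation of an operator. -/
def canRel (m : Formula Agent → Formula Agent) (w v : World Agent) : Prop :=
  ∀ φ, m φ ∈ w.1 → φ ∈ v.1

section Operators

variable {m k : Formula Agent → Formula Agent}

theorem IsNormal.isTheory (hm : IsNormal m) (w : World Agent) : IsTheory {φ | m φ ∈ w.1} where
  thm h := w.2.thm (hm.nec h)
  mp h₁ h₂ := w.2.mp (w.mp (hm.dist _ _) h₁) h₂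

theorem IsNormal.mono (hm : IsNormal m) (w : World Agent) {φ ψ : Formula Agent}
    (h : Lambda_R' (φ.imp ψ)) (hφ : m φ ∈ w.1) : m ψ ∈ w.1 :=
  (hm.isTheory w).mp ((hm.isTheory w).thm h) hφ

theorem IsNormal.mem_iff (hm : IsNormal m) (w : World Agent) {φ : Formula Agent} :
    m φ ∈ w.1 ↔ ∀ v, canRel m w v → φ ∈ v.1 := by
  refine ⟨fun h v hv => hv φ h, fun h => ?_⟩
  by_contra hn
  obtain ⟨M, hM, hwM, hφ⟩ := (hm.isTheory w).exists_mcs hn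
  exact hφ (h ⟨M, hM⟩ hwM)

theorem IsNormal.comp (hk : IsNormal k) (hm : IsNormal m) : IsNormal (fun φ => k (m φ)) where
  dist φ ψ := .of_forall_world fun w => by
    simp only [w.imp_mem]
    exact fun h₁ h₂ => (hk.isTheory w).mp (hk.mono w (hm.dist φ ψ) h₁) h₂
  nec h := hk.nec (hm.nec h)

theorem IsS5.canRel_eucl (hm : IsS5 m) {w v u : World Agent} (hv : canRel m w v)
    (hu : canRel m w u) : canRel m v u := by
  intro (φ : Formula Agent) hφ
  apply hu
  by_contra hn
  have h₁ : (m φ.neg.neg).neg ∈ w.1 := w.neg_mem.2 fun h =>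
    hn (hm.mono w (.of_forall_world fun x => by simp [x.imp_mem, x.neg_mem]) h)
  refine v.neg_mem.1 (hv _ (w.mp (hm.eucl _) h₁)) (hm.mono v ?_ hφ)
  exact .of_forall_world fun x => by simp [x.imp_mem, x.neg_mem]

theorem IsS5.equivalence (hm : IsS5 m) : Equivalence (canRel m) where
  refl w φ := w.mp (hm.refl φ)
  symm {w _} h := hm.canRel_eucl h fun φ => w.mp (hm.refl φ)
  trans h₁ h₂ := hm.canRel_eucl
    (hm.canRel_eucl h₁ fun φ => World.mp _ (hm.refl φ)) h₂

/-- The canonical relation of a composite operator is the composite relation. -/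
theorem IsS5.exists_of_canRel_comp (hm : IsS5 m) (hk : IsNormal k) {w v : World Agent}
    (h : canRel (fun φ => k (m φ)) w v) : ∃ u, canRel k w u ∧ canRel m u v := by
  obtain ⟨u, hwu, hvu⟩ := (hk.isTheory w).exists_common_world (hm.isTheory v) (by
    intro φ (hφ : k φ ∈ w.1) (hφ' : m φ.neg ∈ v.1)
    refine v.neg_mem.1 (h (m φ.neg).neg (hk.mono w (.of_forall_world fun x => ?_) hφ)) hφ'
    refine x.imp_mem.2 fun hx => x.mp (hm.eucl φ) (x.neg_mem.2 fun hn => ?_)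
    exact x.neg_mem.1 (x.mp (hm.refl _) hn) hx)
  exact ⟨u, hwu, hm.equivalence.symm hvu⟩

end Operators

theorem isS5_box : IsS5 (Formula.box (Agent := Agent)) where
  dist := .boxK
  nec := .necBox
  refl := .boxT
  eucl := .box5

theorem isS5_stit (a : Agent) : IsS5 (Formula.stit a) where
  dist := .stitK a
  nec := .necStit a
  refl := .stitT a
  eucl := .stit5 a

theorem isS5_know (a : Agent) : IsS5 (Formula.know a) where
  dist := .knowK a
  nec := .necKnow a
  refl := .knowT a
  eucl := .know5 a

theorem isNormal_intend (a : Agent) : IsNormal (Formula.intend a) := ⟨.intK a, .necInt a⟩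

theorem isNormal_oughtO (a : Agent) : IsNormal (Formula.oughtO a) := ⟨.a1 a, .necOO a⟩

theorem isNormal_oughtS (a : Agent) : IsNormal (Formula.oughtS a) := ⟨.a5 a, .necOS a⟩

theorem World.diam_mem (w : World Agent) {φ : Formula Agent} :
    φ.diam ∈ w.1 ↔ ∃ v, canRel .box w v ∧ φ ∈ v.1 := by
  simp [Formula.diam, w.neg_mem, isS5_box.mem_iff w, World.neg_mem]

/-! ### The canonical frame -/

theorem canRel_box_of_stit {a : Agent} {w v : World Agent} (h : canRel (.stit a) w v) :
    canRel .box w v :=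
  fun φ hφ => h φ (w.mp (.set a φ) hφ)

theorem canRel_stit_know {a : Agent} {w v : World Agent} (h : canRel (.stit a) w v) :
    canRel (.know a) w v :=
  fun φ hφ => h φ (w.mp (.oac a φ) hφ)

theorem canRel_unifH {a : Agent} {v u v' : World Agent} (h : canRel (.know a) v u)
    (hv' : canRel .box v v') : ∃ u', canRel .box u u' ∧ canRel (.know a) v' u' := by
  obtain ⟨u', h₁, h₂⟩ := ((isS5_know a).isTheory v').exists_common_world (isS5_box.isTheory u) (by
    intro φ (hφ : φ.know a ∈ v'.1) (hφ' : φ.neg.box ∈ u.1)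
    exact u.neg_mem.1 (h φ.diam (v.mp (.unifH a φ) (v.diam_mem.2 ⟨v', hv', hφ⟩))) hφ')
  exact ⟨u', h₂, h₁⟩

theorem World.bigConj_mem (w : World Agent) (φ : Formula Agent) (l : List (Formula Agent)) :
    bigConj φ l ∈ w.1 ↔ ∀ ψ ∈ φ :: l, ψ ∈ w.1 := by
  induction l generalizing φ with
  | nil => simp [bigConj]
  | cons ψ l ih => rw [bigConj, w.conj_mem, ih]; simp

/-- Independence of agents in the canonical frame. -/
theorem exists_forall_canRel_stit [Finite Agent] (w : World Agent) (v : Agent → World Agent)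
    (hv : ∀ a, canRel .box w (v a)) : ∃ u, ∀ a, canRel (.stit a) (v a) u := by
  cases isEmpty_or_nonempty Agent with
  | inl _ => exact ⟨w, fun a => isEmptyElim a⟩
  | inr _ =>
    have := Fintype.ofFinite Agent
    obtain ⟨a₀, l, hl⟩ : ∃ a₀ l, (Finset.univ : Finset Agent).toList = a₀ :: l := by
      apply List.exists_cons_of_ne_nil
      simpa using Finset.univ_nonempty.ne_empty
    have hmem : ∀ a, a ∈ a₀ :: l := by simp [← hl]
    have hnodup : (a₀ :: l).Nodup := hl ▸ Finset.nodup_toList _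
    let C : (Agent → Formula Agent) → Formula Agent := fun f =>
      bigConj (.stit a₀ (f a₀)) (l.map fun a => .stit a (f a))
    have hC : ∀ f (x : World Agent), C f ∈ x.1 ↔ ∀ a, (f a).stit a ∈ x.1 := by
      intro f x
      simp only [C]
      rw [x.bigConj_mem]
      constructor
      · intro h a
        apply h
        rcases List.mem_cons.1 (hmem a) with rfl | ha
        · exact List.mem_cons_self
        · exact List.mem_cons_of_mem _ (List.mem_map.2 ⟨a, ha, rfl⟩)
      · intro h ψ hψ
        rcases List.mem_cons.1 hψ with rfl | hψ
        · exact h _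
        · obtain ⟨a, -, rfl⟩ := List.mem_map.1 hψ
          exact h a
    have hdiam : ∀ f : Agent → Formula Agent, (∀ a, (f a).stit a ∈ (v a).1) →
        (C f).diam ∈ w.1 := by
      intro f hf
      have hax := Lambda_R'.indep (a₀, f a₀) (l.map fun a => (a, f a))
        (by simpa [Function.comp_def] using hnodup)
      simp only [List.map_map, Function.comp_def] at hax
      refine w.mp hax ((w.bigConj_mem _ _).2 fun ψ hψ => ?_)
      rcases List.mem_cons.1 hψ with rfl | hψ
      · exact w.diam_mem.2 ⟨_, hv _, hf _⟩
      · obtain ⟨a, -, rfl⟩ := List.mem_map.1 hψ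
        exact w.diam_mem.2 ⟨_, hv a, hf a⟩
    let T : Set (Formula Agent) :=
      {χ | ∃ f : Agent → Formula Agent, (∀ a, (f a).stit a ∈ (v a).1) ∧ ((C f).imp χ).box ∈ w.1}
    have htop : ∀ a (x : World Agent), (((Formula.atom 0).imp (.atom 0)).stit a) ∈ x.1 :=
      fun a x => x.2.thm (.necStit a (.imp_self _))
    have hT : IsTheory T := by
      constructor
      · intro χ hχ
        exact ⟨fun _ => (Formula.atom 0).imp (.atom 0), fun a => htop a _,
          w.2.thm (.necBox (.mp (.imp_intro _ _) hχ))⟩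
      · rintro χ ξ ⟨f, hf, h₁⟩ ⟨g, hg, h₂⟩
        refine ⟨fun a => (f a).conj (g a), fun a => ?_, ?_⟩
        · exact ((isS5_stit a).isTheory _).mp
            ((isS5_stit a).mono _ (.conj_intro _ _) (hf a)) (hg a)
        · rw [isS5_box.mem_iff] at h₁ h₂ ⊢
          intro x hx
          have h₁ := h₁ x hx
          have h₂ := h₂ x hx
          simp only [x.imp_mem, hC] at h₁ h₂ ⊢
          intro h
          exact h₁ (fun a => (isS5_stit a).mono x (.conj_left _ _) (h a))
            (h₂ fun a => (isS5_stit a).mono x (.conj_right _ _) (h a))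
    obtain ⟨M, hM, hTM, -⟩ := hT.exists_mcs (φ := ((Formula.atom 0).imp (.atom 0)).neg) (by
      rintro ⟨f, hf, h⟩
      obtain ⟨x, hx, hxC⟩ := w.diam_mem.1 (hdiam f hf)
      exact x.neg_mem.1 (x.imp_mem.1 (hx _ h) hxC) (x.2.thm (.imp_self _)))
    refine ⟨⟨M, hM⟩, fun a φ hφ => hTM ?_⟩
    classical
    let f : Agent → Formula Agent := fun b => if b = a then φ else (Formula.atom 0).imp (.atom 0)
    have hfa : f a = φ := if_pos rfl
    refine ⟨f, fun b => ?_, w.2.thm (.necBox (.of_forall_world fun x => x.imp_mem.2 fun h => ?_))⟩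
    · by_cases hb : b = a
      · subst hb
        rwa [hfa]
      · simpa only [f, if_neg hb] using htop b _
    · exact x.mp (.stitT a φ) (hfa ▸ (hC f x).1 h a)

theorem canRel_know_box_of_intend {a : Agent} {w v : World Agent}
    (h : canRel (.intend a) w v) : ∃ u, canRel (.know a) w u ∧ canRel .box u v := by
  obtain ⟨u, hwu, huv⟩ := (isS5_know a).exists_of_canRel_comp isS5_box.toIsNormal
    (w := w) (v := v) fun φ hφ => h φ (w.mp (.inN a φ) hφ)
  obtain ⟨u', h₁, h₂⟩ := canRel_unifH huv (isS5_box.equivalence.symm hwu)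
  exact ⟨u', h₂, isS5_box.equivalence.symm h₁⟩

theorem intend_mem_iff {a : Agent} {w u v : World Agent} (h₁ : canRel (.know a) w u)
    (h₂ : canRel .box u v) (φ : Formula Agent) : φ.intend a ∈ w.1 ↔ φ.intend a ∈ v.1 := by
  have hk : ∀ {x y : World Agent}, canRel (.know a) x y → φ.intend a ∈ x.1 → φ.intend a ∈ y.1 :=
    fun {x y} h hx => h _ (x.mp (.boxT _) (x.mp (.ki a φ) hx))
  have hb : ∀ {x y : World Agent}, canRel .box x y → φ.intend a ∈ x.1 → φ.intend a ∈ y.1 :=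
    fun {x y} h hx => y.mp (.knowT a _) (h _ (x.mp (.ki a φ) hx))
  exact ⟨fun h => hb h₂ (hk h₁ h), fun h =>
    hk ((isS5_know a).equivalence.symm h₁) (hb (isS5_box.equivalence.symm h₂) h)⟩

theorem exists_canRel_intend (a : Agent) (w : World Agent) : ∃ v, canRel (.intend a) w v := by
  obtain ⟨v, hv, -⟩ := ((isNormal_intend a).isTheory w).exists_common_world
    ((isNormal_intend a).isTheory w) fun φ hφ => w.neg_mem.1 (w.mp (.intD a φ) hφ)
  exact ⟨v, hv⟩

theorem canRel_intend_congr {a : Agent} {w v : World Agent}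
    (h : ∃ u, canRel (.know a) w u ∧ canRel .box u v) (z : World Agent) :
    canRel (.intend a) w z ↔ canRel (.intend a) v z := by
  obtain ⟨u, h₁, h₂⟩ := h
  simp only [canRel, intend_mem_iff h₁ h₂]

/-! ### Values -/

/-- Worlds of the canonical model at which an agent does all that it objectively ought to do. -/
def OptO (a : Agent) (w : World Agent) : Prop := canRel (.oughtO a) w w

/-- Worlds of the canonical model at which an agent does all that it subjectively ought to do. -/
def OptS (a : Agent) (w : World Agent) : Prop := canRel (.oughtS a) w w

theorem oughtO_mem_of_box {a : Agent} {w v : World Agent} (h : canRel .box w v)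
    {φ : Formula Agent} (hφ : φ.oughtO a ∈ w.1) : φ.oughtO a ∈ v.1 :=
  h _ (w.mp (.a3 a φ) hφ)

theorem oughtS_mem_of_box {a : Agent} {w v : World Agent} (h : canRel .box w v)
    {φ : Formula Agent} (hφ : φ.oughtS a ∈ w.1) : φ.oughtS a ∈ v.1 :=
  h _ (w.mp (.knowT a _) (w.mp (.sCl a φ) hφ))

theorem oughtS_mem_of_know {a : Agent} {w v : World Agent} (h : canRel (.know a) w v)
    {φ : Formula Agent} (hφ : φ.oughtS a ∈ w.1) : φ.oughtS a ∈ v.1 :=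
  v.mp (.boxT _) (h _ (w.mp (.sCl a φ) hφ))

theorem OptO.of_stit {a : Agent} {w v : World Agent} (hw : OptO a w)
    (h : canRel (.stit a) w v) : OptO a v := fun φ hφ =>
  h φ (hw _ (w.mp (.a4 a φ)
    (oughtO_mem_of_box (isS5_box.equivalence.symm (canRel_box_of_stit h)) hφ)))

theorem OptS.of_know {a : Agent} {w v : World Agent} (hw : OptS a w)
    (h : canRel (.know a) w v) : OptS a v := fun φ hφ =>
  h φ (hw _ (w.mp (.a6 a φ) (oughtS_mem_of_know ((isS5_know a).equivalence.symm h) hφ)))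

theorem optO_of_oughtO {a : Agent} {w v : World Agent} (h : canRel (.oughtO a) w v) :
    canRel .box w v ∧ OptO a v := by
  have hb : canRel .box w v := fun φ hφ => h φ (w.mp (.a2 a φ) hφ)
  exact ⟨hb, fun φ hφ => h φ (oughtO_mem_of_box (isS5_box.equivalence.symm hb) hφ)⟩

theorem exists_canRel_oughtO (a : Agent) (w : World Agent) : ∃ v, canRel (.oughtO a) w v := by
  obtain ⟨v, hv, -⟩ := ((isNormal_oughtO a).isTheory w).exists_common_world
    ((isNormal_oughtO a).isTheory w) (by
      intro φ hφ hφ'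
      have h : ((φ.neg).conj φ).oughtO a ∈ w.1 := ((isNormal_oughtO a).isTheory w).mp
        ((isNormal_oughtO a).mono w (.conj_intro _ _) hφ') hφ
      obtain ⟨x, -, hx⟩ := w.diam_mem.1 (w.mp (.oic a _) h)
      have hx := x.conj_mem.1 (x.mp (.stitT a _) hx)
      exact x.neg_mem.1 hx.1 hx.2)
  exact ⟨v, hv⟩

theorem exists_optS (a : Agent) (w : World Agent) : ∃ v, canRel .box w v ∧ OptS a v := by
  obtain ⟨v, hv, hb⟩ := ((isNormal_oughtS a).isTheory w).exists_common_world
    (isS5_box.isTheory w) (by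
      intro φ hφ hφ'
      obtain ⟨x, hx, hφx⟩ := w.diam_mem.1 (w.mp (.sOic a φ) hφ)
      exact x.neg_mem.1 (hx _ hφ') (x.mp (.knowT a φ) hφx))
  exact ⟨v, hb, fun φ hφ => hv (oughtS_mem_of_box (isS5_box.equivalence.symm hb) hφ)⟩

theorem optS_of_oughtS {a : Agent} {w v : World Agent} (h : canRel (.oughtS a) w v) :
    (∃ u, canRel (.know a) w u ∧ canRel .box u v) ∧ OptS a v := by
  obtain ⟨u, h₁, h₂⟩ := isS5_box.exists_of_canRel_comp (isS5_know a).toIsNormal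
    (w := w) (v := v) fun φ hφ => h φ (w.mp (.suN a φ) hφ)
  exact ⟨⟨u, h₁, h₂⟩, fun φ hφ => h φ (oughtS_mem_of_know ((isS5_know a).equivalence.symm h₁)
    (oughtS_mem_of_box (isS5_box.equivalence.symm h₂) hφ))⟩

open Classical in
/-- The number of agents satisfying a property at a point. -/
noncomputable def countAgents [Fintype Agent] {X : Type} (P : Agent → X → Prop) (x : X) : ℝ :=
  ∑ a, if P a x then 1 else 0

theorem countAgents_le_iff [Fintype Agent] {X : Type} {P : Agent → X → Prop} {a : Agent} {x y : X}
    (h : ∀ b, b ≠ a → (P b x ↔ P b y)) :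
    countAgents P x ≤ countAgents P y ↔ (P a x → P a y) := by
  classical
  unfold countAgents
  rw [← Finset.add_sum_erase _ _ (Finset.mem_univ a), ← Finset.add_sum_erase _ _ (Finset.mem_univ a),
    Finset.sum_congr (g := fun b => if P b y then (1 : ℝ) else 0) rfl
      fun b hb => by simp [h b (Finset.ne_of_mem_erase hb)], add_le_add_iff_right]
  by_cases hx : P a x <;> by_cases hy : P a y <;> simp [hx, hy]

/-! ### The canonical model -/

/-- The canonical choice cell of an agent at a world. -/
def canCell (a : Agent) (w : World Agent) : Set (World Agent) := {v | canRel (.stit a) w v}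

theorem mem_canCell_self (a : Agent) (w : World Agent) : w ∈ canCell a w :=
  (isS5_stit a).equivalence.refl w

theorem canCell_eq {a : Agent} {w v : World Agent} (h : v ∈ canCell a w) :
    canCell a w = canCell a v := by
  have e := (isS5_stit a).equivalence
  exact Set.ext fun u => ⟨e.trans (e.symm h), e.trans h⟩

/-- The canonical model. -/
noncomputable def canModel (Agent : Type) [Fintype Agent] : KripkeModel Agent where
  W := World Agent
  ags_fin := inferInstance
  rbox := canRel .box
  rbox_equiv := isS5_box.equivalence
  Choice a w := {L | ∃ v, canRel .box w v ∧ L = canCell a v}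
  choice_congr a w v h := by
    have e := isS5_box.equivalence (Agent := Agent)
    ext L
    exact ⟨fun ⟨u, hu, hL⟩ => ⟨u, e.trans (e.symm h) hu, hL⟩, fun ⟨u, hu, hL⟩ => ⟨u, e.trans h hu, hL⟩⟩
  choice_sub := by
    rintro a w _ ⟨v, hv, rfl⟩ u hu
    exact isS5_box.equivalence.trans hv (canRel_box_of_stit hu)
  choice_ne := by
    rintro a w _ ⟨v, hv, rfl⟩
    exact ⟨v, mem_canCell_self a v⟩
  choice_cover a w v h := ⟨_, ⟨v, h, rfl⟩, mem_canCell_self a v⟩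
  choice_disj := by
    rintro a w _ ⟨v, -, rfl⟩ _ ⟨u, -, rfl⟩ x hx hx'
    rw [canCell_eq hx, canCell_eq hx']
  ia w s hs := by
    choose v hv hsv using hs
    obtain ⟨u, hu⟩ := exists_forall_canRel_stit w v hv
    exact ⟨u, Set.mem_iInter.2 fun a => hsv a ▸ hu a⟩
  aeq a := canRel (.know a)
  aeq_equiv a := (isS5_know a).equivalence
  oacK := by
    rintro a w _ ⟨v, -, rfl⟩ hw u hu
    rw [canCell_eq hw] at hu
    exact canRel_stit_know hu
  unifHK a v u h v' hv' := canRel_unifH h hv'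
  ri a := canRel (.intend a)
  ri_serial := exists_canRel_intend
  ri_trans a _ _ z h₁ h₂ := (canRel_intend_congr (canRel_know_box_of_intend h₁) z).2 h₂
  ri_eucl a _ _ z h₁ h₂ := (canRel_intend_congr (canRel_know_box_of_intend h₁) z).1 h₂
  ri_sub a _ _ h := canRel_know_box_of_intend h
  denK a v u h := by
    obtain ⟨z, hz⟩ := exists_canRel_intend a v
    exact ⟨z, hz, (canRel_intend_congr h z).1 hz⟩
  ValueO := countAgents OptO
  ValueS := countAgents OptS
  val n := {w | Formula.atom n ∈ w.1}

section Model

/-- A choice cell meets every state of the corresponding moment. -/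
theorem KripkeModel.exists_mem_inter (M : KripkeModel Agent) (a : Agent) (w : M.W)
    (s : Agent → Set M.W) (hs : ∀ b, s b ∈ M.Choice b w) {L : Set M.W} (hL : L ∈ M.Choice a w) :
    ∃ x ∈ L, ∀ b, b ≠ a → x ∈ s b := by
  classical
  obtain ⟨x, hx⟩ := M.ia w (Function.update s a L) fun b => by
    by_cases hb : b = a
    · subst hb; simpa using hL
    · simpa [hb] using hs b
  rw [Set.mem_iInter] at hx
  exact ⟨x, by simpa using hx a, fun b hb => by simpa [hb] using hx b⟩

theorem KripkeModel.exists_choice (M : KripkeModel Agent) (w : M.W) :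
    ∃ s : Agent → Set M.W, ∀ b, s b ∈ M.Choice b w := by
  choose s hs _ using fun b => M.choice_cover b w w (M.rbox_equiv.refl w)
  exact ⟨s, hs⟩

theorem mem_kState_inter {M : KripkeModel Agent} {a : Agent} {s : Agent → Set M.W} {x : M.W} :
    x ∈ ⋂ b ∈ {b : Agent | b ≠ a}, s b ↔ ∀ b, b ≠ a → x ∈ s b := by
  simp

variable [Fintype Agent] {a : Agent} {w : World Agent} {L L' : Set (World Agent)}

theorem canRel_stit_of_mem_choice (hL : L ∈ (canModel Agent).Choice a w) {x y : World Agent}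
    (hx : x ∈ L) (hy : y ∈ L) : canRel (.stit a) x y := by
  obtain ⟨v, -, rfl⟩ := hL
  rwa [canCell_eq hx] at hy

theorem canModel_kdom_iff (hL : L ∈ (canModel Agent).Choice a w)
    (hL' : L' ∈ (canModel Agent).Choice a w) {x y : World Agent} (hx : x ∈ L) (hy : y ∈ L') :
    kdom (canModel Agent) a w L L' ↔ (OptO a x → OptO a y) := by
  have key : ∀ s : Agent → Set (World Agent), (∀ b, s b ∈ (canModel Agent).Choice b w) →
      ∀ p ∈ L, (∀ b, b ≠ a → p ∈ s b) → ∀ q ∈ L', (∀ b, b ≠ a → q ∈ s b) →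
      ((canModel Agent).ValueO p ≤ (canModel Agent).ValueO q ↔ (OptO a x → OptO a y)) := by
    intro s hs p hp hps q hq hqs
    refine (countAgents_le_iff (a := a) fun b hb => ?_).trans ?_
    · exact ⟨fun h => h.of_stit (canRel_stit_of_mem_choice (hs b) (hps b hb) (hqs b hb)),
        fun h => h.of_stit (canRel_stit_of_mem_choice (hs b) (hqs b hb) (hps b hb))⟩
    · exact ⟨fun h h' => (h (h'.of_stit (canRel_stit_of_mem_choice hL hx hp))).of_stit
          (canRel_stit_of_mem_choice hL' hq hy),
        fun h h' => (h (h'.of_stit (canRel_stit_of_mem_choice hL hp hx))).of_stit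
          (canRel_stit_of_mem_choice hL' hy hq)⟩
  constructor
  · intro h
    obtain ⟨s, hs⟩ := (canModel Agent).exists_choice w
    obtain ⟨p, hp, hps⟩ := (canModel Agent).exists_mem_inter a w s hs hL
    obtain ⟨q, hq, hqs⟩ := (canModel Agent).exists_mem_inter a w s hs hL'
    exact (key s hs p hp hps q hq hqs).1
      (h _ ⟨s, hs, rfl⟩ p ⟨hp, mem_kState_inter.2 hps⟩ q ⟨hq, mem_kState_inter.2 hqs⟩)
  · rintro h _ ⟨s, hs, rfl⟩ p ⟨hp, hps⟩ q ⟨hq, hqs⟩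
    exact (key s hs p hp (mem_kState_inter.1 hps) q hq (mem_kState_inter.1 hqs)).2 h

theorem canModel_kdomS_iff (hL : L ∈ (canModel Agent).Choice a w)
    (hL' : L' ∈ (canModel Agent).Choice a w) {x y : World Agent} (hx : x ∈ L) (hy : y ∈ L') :
    kdomS (canModel Agent) a w L L' ↔ (OptS a x → OptS a y) := by
  have e := (isS5_know a).equivalence
  have key : ∀ (v : World Agent) (s : Agent → Set (World Agent)),
      (∀ b, s b ∈ (canModel Agent).Choice b v) →
      ∀ p ∈ kcluster (canModel Agent) a L v, (∀ b, b ≠ a → p ∈ s b) →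
      ∀ q ∈ kcluster (canModel Agent) a L' v, (∀ b, b ≠ a → q ∈ s b) →
      ((canModel Agent).ValueS p ≤ (canModel Agent).ValueS q ↔ (OptS a x → OptS a y)) := by
    rintro v s hs p ⟨-, o, ho, hop⟩ hps q ⟨-, o', ho', hoq⟩ hqs
    have hxp : canRel (.know a) x p :=
      e.trans (canRel_stit_know (canRel_stit_of_mem_choice hL hx ho)) hop
    have hyq : canRel (.know a) y q :=
      e.trans (canRel_stit_know (canRel_stit_of_mem_choice hL' hy ho')) hoq
    refine (countAgents_le_iff (a := a) fun b hb => ?_).trans ?_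
    · exact ⟨fun h => h.of_know (canRel_stit_know
          (canRel_stit_of_mem_choice (hs b) (hps b hb) (hqs b hb))),
        fun h => h.of_know (canRel_stit_know
          (canRel_stit_of_mem_choice (hs b) (hqs b hb) (hps b hb)))⟩
    · exact ⟨fun h h' => (h (h'.of_know hxp)).of_know (e.symm hyq),
        fun h h' => (h (h'.of_know (e.symm hxp))).of_know hyq⟩
  constructor
  · intro h
    obtain ⟨s, hs⟩ := (canModel Agent).exists_choice w
    obtain ⟨p, hp, hps⟩ := (canModel Agent).exists_mem_inter a w s hs hL
    obtain ⟨q, hq, hqs⟩ := (canModel Agent).exists_mem_inter a w s hs hL'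
    have hp' : p ∈ kcluster (canModel Agent) a L w :=
      ⟨(canModel Agent).choice_sub a w L hL p hp, p, hp, e.refl p⟩
    have hq' : q ∈ kcluster (canModel Agent) a L' w :=
      ⟨(canModel Agent).choice_sub a w L' hL' q hq, q, hq, e.refl q⟩
    exact (key w s hs p hp' hps q hq' hqs).1 (h w (e.refl w) _ ⟨s, hs, rfl⟩
      p ⟨hp', mem_kState_inter.2 hps⟩ q ⟨hq', mem_kState_inter.2 hqs⟩)
  · rintro h v - _ ⟨s, hs, rfl⟩ p ⟨hp, hps⟩ q ⟨hq, hqs⟩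
    exact (key v s hs p hp (mem_kState_inter.1 hps) q hq (mem_kState_inter.1 hqs)).2 h

theorem ktruth_oughtO_iff {φ : Formula Agent}
    (ih : ∀ v : World Agent, ktruth (canModel Agent) φ v ↔ φ ∈ v.1) :
    ktruth (canModel Agent) (.oughtO a φ) w ↔ φ.oughtO a ∈ w.1 := by
  have eb := isS5_box.equivalence (Agent := Agent)
  constructor
  · intro h
    refine ((isNormal_oughtO a).mem_iff w).2 fun v hv => ?_
    by_contra hφ
    obtain ⟨hwv, hopt⟩ := optO_of_oughtO hv
    have hL : canCell a v ∈ (canModel Agent).Choice a w := ⟨v, hwv, rfl⟩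
    obtain ⟨L', hL', ⟨h₁, h₂⟩, -⟩ := h _ hL ⟨v, mem_canCell_self a v, fun hn => hφ ((ih v).1 hn)⟩
    obtain ⟨y, hy⟩ := (canModel Agent).choice_ne a w L' hL'
    exact h₂ ((canModel_kdom_iff hL' hL hy (mem_canCell_self a v)).2 fun _ => hopt)
  · rintro h L hL ⟨v, hv, hφ⟩
    have hmem : ∀ L ∈ (canModel Agent).Choice a w, ∀ u ∈ L, OptO a u → φ ∈ u.1 :=
      fun L hL u hu ho => ho φ (oughtO_mem_of_box ((canModel Agent).choice_sub a w L hL u hu) h)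
    have hv' : ¬ OptO a v := fun ho => hφ ((ih v).2 (hmem L hL v hv ho))
    obtain ⟨x, hx⟩ := exists_canRel_oughtO a w
    obtain ⟨hwx, hopt⟩ := optO_of_oughtO hx
    have hL' : canCell a x ∈ (canModel Agent).Choice a w := ⟨x, hwx, rfl⟩
    have hxx := mem_canCell_self a x
    refine ⟨canCell a x, hL', ⟨(canModel_kdom_iff hL hL' hv hxx).2 fun _ => hopt,
      fun hd => hv' ((canModel_kdom_iff hL' hL hxx hv).1 hd hopt)⟩, ?_⟩
    rintro L'' hL'' hd u hu
    refine (ih u).2 (hmem L'' hL'' u hu ?_)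
    rcases hd with rfl | hd
    · exact hopt.of_stit hu
    · exact (canModel_kdom_iff hL' hL'' hxx hu).1 hd hopt

theorem ktruth_oughtS_iff {φ : Formula Agent}
    (ih : ∀ v : World Agent, ktruth (canModel Agent) φ v ↔ φ ∈ v.1) :
    ktruth (canModel Agent) (.oughtS a φ) w ↔ φ.oughtS a ∈ w.1 := by
  have ek := (isS5_know a).equivalence
  constructor
  · intro h
    refine ((isNormal_oughtS a).mem_iff w).2 fun v hv => ?_
    by_contra hφ
    obtain ⟨⟨u, hwu, huv⟩, hopt⟩ := optS_of_oughtS hv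
    obtain ⟨v', hwv', hvv'⟩ := canRel_unifH (ek.symm hwu) huv
    have hself := mem_canCell_self a v'
    have hL : canCell a v' ∈ (canModel Agent).Choice a w := ⟨v', hwv', rfl⟩
    obtain ⟨L', hL', ⟨h₁, h₂⟩, -⟩ := h _ hL
      ⟨u, hwu, v, ⟨huv, v', hself, ek.symm hvv'⟩, fun hn => hφ ((ih v).1 hn)⟩
    obtain ⟨y, hy⟩ := (canModel Agent).choice_ne a w L' hL'
    exact h₂ ((canModel_kdomS_iff hL' hL hy hself).2 fun _ => hopt.of_know hvv')
  · rintro h L hL ⟨w', hw', v, ⟨hw'v, o, ho, hov⟩, hφ⟩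
    have hmem : ∀ L ∈ (canModel Agent).Choice a w, ∀ o ∈ L, OptS a o →
        ∀ u, canRel (.know a) o u → φ ∈ u.1 :=
      fun L hL o ho hopt u hu => hopt.of_know hu φ (oughtS_mem_of_know hu
        (oughtS_mem_of_box ((canModel Agent).choice_sub a w L hL o ho) h))
    have ho' : ¬ OptS a o := fun hopt => hφ ((ih v).2 (hmem L hL o ho hopt v hov))
    obtain ⟨x, hwx, hopt⟩ := exists_optS a w
    have hL' : canCell a x ∈ (canModel Agent).Choice a w := ⟨x, hwx, rfl⟩
    have hxx := mem_canCell_self a x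
    refine ⟨canCell a x, hL', ⟨(canModel_kdomS_iff hL hL' ho hxx).2 fun _ => hopt,
      fun hd => ho' ((canModel_kdomS_iff hL' hL hxx ho).1 hd hopt)⟩, ?_⟩
    rintro L'' hL'' hd w'' - u ⟨-, o', ho'', hu⟩
    refine (ih u).2 (hmem L'' hL'' o' ho'' ?_ u hu)
    rcases hd with rfl | hd
    · exact hopt.of_know (canRel_stit_know ho'')
    · exact (canModel_kdomS_iff hL' hL'' hxx ho'').1 hd hopt

theorem ktruth_intend_iff {φ : Formula Agent}
    (ih : ∀ v : World Agent, ktruth (canModel Agent) φ v ↔ φ ∈ v.1) :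
    ktruth (canModel Agent) (.intend a φ) w ↔ φ.intend a ∈ w.1 := by
  constructor
  · rintro ⟨x, hx, h⟩
    exact ((isNormal_intend a).mem_iff w).2 fun v hv =>
      (ih v).1 (h v (.inr ((canRel_intend_congr hx v).1 hv)))
  · intro h
    obtain ⟨x, hx⟩ := exists_canRel_intend a w
    have hwx := canRel_know_box_of_intend hx
    refine ⟨x, hwx, fun v hv => (ih v).2 ?_⟩
    rcases hv with rfl | hv
    · exact hx φ h
    · exact (canRel_intend_congr hwx v).2 hv φ h

/-- The truth lemma. -/
theorem ktruth_canModel_iff (φ : Formula Agent) (w : World Agent) :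
    ktruth (canModel Agent) φ w ↔ φ ∈ w.1 := by
  induction φ generalizing w with
  | atom n => exact Iff.rfl
  | neg φ ih => exact (not_congr (ih w)).trans w.neg_mem.symm
  | conj φ ψ ih₁ ih₂ => exact (and_congr (ih₁ w) (ih₂ w)).trans w.conj_mem.symm
  | box φ ih =>
    exact (forall₂_congr fun v _ => ih v).trans (isS5_box.mem_iff w).symm
  | stit a φ ih =>
    refine Iff.trans ⟨fun h v hv => ?_, fun h L hL hw v hv => ?_⟩ ((isS5_stit a).mem_iff w).symm
    · exact (ih v).1 (h (canCell a w) ⟨w, isS5_box.equivalence.refl w, rfl⟩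
        (mem_canCell_self a w) v hv)
    · exact (ih v).2 (h v (canRel_stit_of_mem_choice hL hw hv))
  | know a φ ih =>
    exact (forall₂_congr fun v _ => ih v).trans ((isS5_know a).mem_iff w).symm
  | intend a φ ih => exact ktruth_intend_iff ih
  | oughtO a φ ih => exact ktruth_oughtO_iff ih
  | oughtS a φ ih => exact ktruth_oughtS_iff ih

end Model

/-- completeness of `Λ_R'` with respect to bi-valued
Kripke-kios-models. -/
theorem Lambda_R'_complete_kripke {Agent : Type} [Finite Agent]
    (φ : Formula Agent) (hcon : ¬ Lambda_R' (Formula.neg φ)) :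
    ∃ (M : KripkeModel Agent) (w : M.W), ktruth M φ w := by
  have := Fintype.ofFinite Agent
  obtain ⟨M, hM, -, hφ⟩ := isTheory_lambda.exists_mcs hcon
  refine ⟨canModel Agent, ⟨M, hM⟩, (ktruth_canModel_iff φ _).2 ?_⟩
  by_contra hn
  exact hφ ((hM.neg_mem φ).2 hn)

end IEAUST
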